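/- Let f be convex and L-smooth on a real inner product space, let h ∈ (0, 2], and let x1 = x0 - (h/L)∇f(x0) be one exact gradient step from x0. Then (1/L)·‖∇f(x1)‖² ≤ max{ 1/h , 2(h-1)²/(h(2-h)) } · (f(x0) - f(x1)). (Here 2(h-1)²/(h(2-h)) is the expression 2/((1-h)^{-2} - 1) written without singularity; at h = 2 the second term is interpreted so that the bound reads with the max being +∞, i.e. the statement is for h ∈ (0,2).) -/

import Mathlib

theorem aux_line {H : Type*} [NormedAddCommGroup H] [InnerProductSpace ℝ H] [CompleteSpace H]
    (f : H → ℝ) (f' : H → H) (hgrad : ∀ x, HasGradientAt f (f' x) x) (x v : H) (t : ℝ) :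
    HasDerivAt (fun s : ℝ => f (x + s • v)) (inner ℝ (f' (x + t • v)) v) t := by
  have h1 : HasDerivAt (fun s : ℝ => x + s • v) v t := by
    simpa using ((hasDerivAt_id t).smul_const v).const_add x
  have h2 := (hgrad (x + t • v)).hasFDerivAt.comp_hasDerivAt t h1
  rw [InnerProductSpace.toDual_apply_apply] at h2
  exact h2

theorem aux_convex {H : Type*} [NormedAddCommGroup H] [InnerProductSpace ℝ H] [CompleteSpace H]
    (f : H → ℝ) (f' : H → H) (hconv : ConvexOn ℝ Set.univ f)
    (hgrad : ∀ x, HasGradientAt f (f' x) x) (x v : H) :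
    f x + inner ℝ (f' x) v ≤ f (x + v) := by
  have hc : ConvexOn ℝ Set.univ (fun s : ℝ => f (x + s • v)) := by
    refine ⟨convex_univ, ?_⟩
    intro s _ t _ a b ha hb hab
    have := hconv.2 (Set.mem_univ (x + s • v)) (Set.mem_univ (x + t • v)) ha hb hab
    have e : a • (x + s • v) + b • (x + t • v) = x + (a • s + b • t) • v := by
      have : b = 1 - a := by linarith
      subst this
      simp only [smul_eq_mul]
      module
    rw [e] at this
    exact this
  have hd := aux_line f f' hgrad x v 0
  have := hc.le_slope_of_hasDerivAt (Set.mem_univ 0) (Set.mem_univ 1) one_pos hd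
  simp [slope_def_field] at this
  linarith

theorem aux_descent {H : Type*} [NormedAddCommGroup H] [InnerProductSpace ℝ H] [CompleteSpace H]
    (f : H → ℝ) (f' : H → H) (L : ℝ) (hL : 0 < L)
    (hgrad : ∀ x, HasGradientAt f (f' x) x)
    (hlip : LipschitzWith L.toNNReal f') (x v : H) :
    f (x + v) ≤ f x + inner ℝ (f' x) v + L / 2 * ‖v‖ ^ 2 := by
  have hd : ∀ t : ℝ, HasDerivAt
      (fun s : ℝ => f (x + s • v) - s * inner ℝ (f' x) v - L / 2 * ‖v‖ ^ 2 * s ^ 2)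
      (inner ℝ (f' (x + t • v)) v - inner ℝ (f' x) v - L / 2 * ‖v‖ ^ 2 * (2 * t)) t := by
    intro t
    have h1 := aux_line f f' hgrad x v t
    have h2 := (hasDerivAt_id t).mul_const (inner ℝ (f' x) v)
    have h3 := ((hasDerivAt_id t).pow 2).const_mul (L / 2 * ‖v‖ ^ 2)
    have := (h1.sub h2).sub h3
    refine HasDerivAt.congr_deriv this ?_
    simp
  have ha : AntitoneOn
      (fun s : ℝ => f (x + s • v) - s * inner ℝ (f' x) v - L / 2 * ‖v‖ ^ 2 * s ^ 2)
      (Set.Icc 0 1) := by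
    apply antitoneOn_of_deriv_nonpos (convex_Icc 0 1)
    · exact fun t _ => (hd t).continuousAt.continuousWithinAt
    · exact fun t _ => (hd t).differentiableAt.differentiableWithinAt
    · intro t ht
      rw [interior_Icc] at ht
      rw [(hd t).deriv, ← inner_sub_left]
      have h1 := real_inner_le_norm (f' (x + t • v) - f' x) v
      have h2 := hlip.norm_sub_le (x + t • v) x
      rw [add_sub_cancel_left, norm_smul, Real.norm_of_nonneg ht.1.le,
        Real.coe_toNNReal _ hL.le] at h2
      have h3 := mul_le_mul_of_nonneg_right h2 (norm_nonneg v)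
      nlinarith
  have := ha (Set.left_mem_Icc.2 zero_le_one) (Set.right_mem_Icc.2 zero_le_one) zero_le_one
  simp at this
  linarith

theorem aux_interp {H : Type*} [NormedAddCommGroup H] [InnerProductSpace ℝ H] [CompleteSpace H]
    (f : H → ℝ) (f' : H → H) (L : ℝ) (hL : 0 < L)
    (hconv : ConvexOn ℝ Set.univ f)
    (hgrad : ∀ x, HasGradientAt f (f' x) x)
    (hlip : LipschitzWith L.toNNReal f') (x y : H) :
    f x + inner ℝ (f' x) (y - x) + 1 / (2 * L) * ‖f' y - f' x‖ ^ 2 ≤ f y := by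
  have h1 := aux_descent f f' L hL hgrad hlip y (-(1 / L) • (f' y - f' x))
  have h2 := aux_convex f f' hconv hgrad x ((y - x) + -(1 / L) • (f' y - f' x))
  rw [show x + ((y - x) + -(1 / L) • (f' y - f' x)) = y + -(1 / L) • (f' y - f' x) by abel,
    inner_add_right, inner_smul_right] at h2
  rw [inner_smul_right, norm_smul, mul_pow, Real.norm_eq_abs, sq_abs] at h1
  have h3 : inner ℝ (f' y) (f' y - f' x) - inner ℝ (f' x) (f' y - f' x)
      = ‖f' y - f' x‖ ^ 2 := by
    rw [← inner_sub_left, real_inner_self_eq_norm_sq]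
  have h4 : L / 2 * ((-(1 / L)) ^ 2 * ‖f' y - f' x‖ ^ 2)
      = 1 / (2 * L) * ‖f' y - f' x‖ ^ 2 := by
    field_simp
  have h5 : 1 / L * ‖f' y - f' x‖ ^ 2 = 2 * (1 / (2 * L) * ‖f' y - f' x‖ ^ 2) := by
    field_simp
  rw [h4] at h1
  rw [← h3, mul_sub] at h5
  rw [h3] at h5
  linarith


/-- One step of exact gradient descent on a convex `L`-smooth function,
with normalized stepsize `h ∈ (0, 2)`:
`(1/L)·‖∇f(x1)‖² ≤ max { 1/h , 2(h-1)²/(h(2-h)) } · (f(x0) - f(x1))`. -/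
theorem one_step_exact_gd_objective_decrease
    {H : Type*} [NormedAddCommGroup H] [InnerProductSpace ℝ H] [CompleteSpace H]
    (f : H → ℝ) (f' : H → H) (L : ℝ) (hL : 0 < L)
    (hconv : ConvexOn ℝ Set.univ f)
    (hgrad : ∀ x, HasGradientAt f (f' x) x)
    (hlip : LipschitzWith L.toNNReal f')
    (h : ℝ) (hh : h ∈ Set.Ioo (0 : ℝ) 2)
    (x0 x1 : H) (hx1 : x1 = x0 - (h / L) • f' x0) :
    (1 / L) * ‖f' x1‖ ^ 2 ≤
      max (1 / h) (2 * (h - 1) ^ 2 / (h * (2 - h))) * (f x0 - f x1) := by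


  obtain ⟨hh0, hh2⟩ := hh
  have hA := aux_interp f f' L hL hconv hgrad hlip x1 x0
  have hB := aux_interp f f' L hL hconv hgrad hlip x0 x1
  rw [show x0 - x1 = (h / L) • f' x0 by rw [hx1]; abel, inner_smul_right,
    norm_sub_sq_real, real_inner_comm] at hA
  rw [show x1 - x0 = -(h / L) • f' x0 by rw [hx1]; module, inner_smul_right,
    real_inner_self_eq_norm_sq, norm_sub_rev, norm_sub_sq_real] at hB
  have hS : 0 ≤ ‖f' x0 - f' x1‖ ^ 2 := by positivity
  have hT : 0 ≤ ‖(h - 1) • f' x0 + f' x1‖ ^ 2 := by positivity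
  rw [norm_sub_sq_real] at hS
  rw [norm_add_sq_real, inner_smul_left, norm_smul, mul_pow, Real.norm_eq_abs, sq_abs] at hT
  simp only [conj_trivial] at hT
  obtain ⟨D, hD⟩ : ∃ D, D = f x0 - f x1 := ⟨_, rfl⟩
  rw [← hD]
  generalize ‖f' x0‖ ^ 2 = a at *
  have hc : 0 ≤ ‖f' x1‖ ^ 2 := by positivity
  generalize ‖f' x1‖ ^ 2 = c at *
  generalize inner ℝ (f' x0) (f' x1) = b at *
  have hA' : a / 2 + (h - 1) * b + c / 2 ≤ L * D := by
    have := mul_le_mul_of_nonneg_left hA hL.le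
    have e : L * (f x1 + h / L * b + 1 / (2 * L) * (a - 2 * b + c))
      = L * f x1 + h * b + (a - 2 * b + c) / 2 := by field_simp
    rw [e] at this
    rw [hD]; linarith
  have hB' : (1 / 2 - h) * a - b + c / 2 ≤ -(L * D) := by
    have := mul_le_mul_of_nonneg_left hB hL.le
    have e : L * (f x0 + -(h / L) * a + 1 / (2 * L) * (a - 2 * b + c))
      = L * f x0 - h * a + (a - 2 * b + c) / 2 := by field_simp; ring
    rw [e] at this
    rw [hD]; linarith
  have key : ∃ M, M ≤ max (1 / h) (2 * (h - 1) ^ 2 / (h * (2 - h))) ∧ 0 ≤ M ∧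
      c ≤ M * (L * D) ∧ 0 ≤ L * D := by
    rcases le_total h (3 / 2) with h3 | h3
    · have k : h * c ≤ L * D := by
        nlinarith [mul_nonneg (sub_nonneg.2 h3) hS]
      refine ⟨_, le_max_left _ _, by positivity, ?_, le_trans (by positivity) k⟩
      rw [one_div, ← div_eq_inv_mul, le_div_iff₀ hh0]
      linarith
    · have h2 : 0 < 2 - h := by linarith
      have h1 : 0 < h - 1 := by linarith
      have k : h * (2 - h) * c ≤ 2 * (h - 1) ^ 2 * (L * D) := by
        nlinarith [mul_nonneg (sub_nonneg.2 h3) hT, mul_le_mul_of_nonneg_left hA' h1.le,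
          mul_le_mul_of_nonneg_left hB' (mul_pos h1 h2).le]
      refine ⟨_, le_max_right _ _, by positivity, ?_, ?_⟩
      · rw [div_mul_eq_mul_div, le_div_iff₀ (by positivity)]
        linarith
      · have : 0 ≤ 2 * (h - 1) ^ 2 * (L * D) := le_trans (by positivity) k
        exact nonneg_of_mul_nonneg_right this (by positivity)
  obtain ⟨M, hM, hM0, hcM, hLD⟩ := key
  have := hcM.trans (mul_le_mul_of_nonneg_right hM hLD)
  rw [one_div, ← div_eq_inv_mul, div_le_iff₀ hL]
  linarith
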